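/- For every tree τ ∈ L (a weakly decreasing binary plane tree in which no vertex has the same label as its right child), one has slow(S(τ)) = P(τ); that is, applying slow to the in-order reading of τ yields the postorder reading of τ. -/

import Mathlib

lemma foldr_max_mem {w : List ℕ} (h : w ≠ []) : w.foldr max 0 ∈ w := by
  induction w with
  | nil => exact absurd rfl h
  | cons a l ih =>
    rcases eq_or_ne l [] with rfl | hl
    · simp
    · have hm := ih hl
      simp only [List.foldr_cons]
      rcases max_choice a (l.foldr max 0) with h' | h' <;> rw [h']
      · exact List.mem_cons_self
      · exact List.mem_cons_of_mem _ hm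

lemma headI_mem {α : Type*} [Inhabited α] {l : List α} (h : l ≠ []) : l.headI ∈ l := by
  cases l with
  | nil => exact absurd rfl h
  | cons a t => simp

/-- `blocks n w` is the list of maximal (possibly empty) blocks of `w`
separated by occurrences of the letter `n`; that is, if `n` occurs `k` times
in `w`, then `blocks n w = [A₁, A₂, …, A_{k+1}]` where `w = A₁ n A₂ n ⋯ n A_{k+1}`
and no `Aᵢ` contains the letter `n`. -/
def blocks (n : ℕ) : List ℕ → List (List ℕ)
  | [] => [[]]
  | a :: l =>
    if a = n then [] :: blocks n l
    else (a :: (blocks n l).headI) :: (blocks n l).tail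

lemma blocks_ne_nil (n : ℕ) (w : List ℕ) : blocks n w ≠ [] := by
  cases w with
  | nil => simp [blocks]
  | cons a l =>
    simp only [blocks]
    split <;> simp

lemma blocks_length {n : ℕ} {w : List ℕ} : ∀ {A : List ℕ}, A ∈ blocks n w →
    A.length + w.count n ≤ w.length := by
  induction w with
  | nil =>
    intro A hA
    simp only [blocks, List.mem_singleton] at hA
    subst hA; simp
  | cons a l ih =>
    intro A hA
    by_cases h : a = n
    · subst h
      simp only [blocks, if_pos rfl] at hA
      have hcc : (a :: l).count a = l.count a + 1 := by simp
      cases hA with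
      | head =>
        have := List.count_le_length (a := a) (l := l)
        simp only [List.length_nil, List.length_cons, hcc]
        omega
      | tail _ h1 =>
        have := ih h1
        simp only [List.length_cons, hcc]
        omega
    · simp only [blocks, if_neg h] at hA
      have hcc : (a :: l).count n = l.count n := by
        simp [List.count_cons, h]
      cases hA with
      | head =>
        have := ih (headI_mem (blocks_ne_nil n l))
        simp only [List.length_cons, hcc]
        omega
      | tail _ h1 =>
        have := ih (List.mem_of_mem_tail h1)
        simp only [List.length_cons, hcc]
        omega

/-- The generalized stack-sorting map `slow` (the convention in which a letter may
not sit on top of a copy of itself in the stack): `slow ε = ε`, and if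
`w = A₁ n A₂ n ⋯ n A_{k+1}` where `n` is the largest letter of `w` (occurring
`k` times) and the `Aᵢ` contain only letters smaller than `n`, then
`slow w = slow A₁ ++ slow A₂ ++ [n] ++ slow A₃ ++ [n] ++ ⋯ ++ slow A_{k+1} ++ [n]`. -/
def slow (w : List ℕ) : List ℕ :=
  if h : w = [] then []
  else
    (have : (blocks (w.foldr max 0) w).headI.length < w.length := by
      have h1 := blocks_length (headI_mem (blocks_ne_nil (w.foldr max 0) w))
      have h2 : 0 < w.count (w.foldr max 0) :=
        List.count_pos_iff.mpr (foldr_max_mem h)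
      omega
     slow (blocks (w.foldr max 0) w).headI) ++
    ((blocks (w.foldr max 0) w).tail.attach.map
      fun (A : {x // x ∈ (blocks (w.foldr max 0) w).tail}) =>
      have : A.1.length < w.length := by
        have h1 := blocks_length (List.mem_of_mem_tail A.2)
        have h2 : 0 < w.count (w.foldr max 0) :=
          List.count_pos_iff.mpr (foldr_max_mem h)
        omega
      slow A.1 ++ [w.foldr max 0]).flatten
termination_by w.length

/-- Binary plane trees labeled by natural numbers: each vertex carries a label and
an ordered pair of (possibly empty) left and right subtrees. -/
inductive BTree where
  | leaf : BTree
  | node : BTree → ℕ → BTree → BTree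

/-- The in-order (symmetric order) reading of a labeled binary plane tree. -/
def BTree.inOrder : BTree → List ℕ
  | .leaf => []
  | .node l v r => l.inOrder ++ v :: r.inOrder

/-- The postorder reading of a labeled binary plane tree. -/
def BTree.postOrder : BTree → List ℕ
  | .leaf => []
  | .node l v r => l.postOrder ++ r.postOrder ++ [v]

/-- The label of the root of a binary plane tree, if the tree is nonempty. -/
def BTree.root? : BTree → Option ℕ
  | .leaf => none
  | .node _ v _ => some v

/-- The tree is weakly decreasing: the label of each nonroot vertex is at most
the label of its parent. -/
def BTree.WeaklyDecreasing : BTree → Prop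
  | .leaf => True
  | .node l v r => (∀ x ∈ l.inOrder, x ≤ v) ∧ (∀ x ∈ r.inOrder, x ≤ v) ∧
      l.WeaklyDecreasing ∧ r.WeaklyDecreasing

/-- All labels of the tree are positive integers. -/
def BTree.PosLabels : BTree → Prop
  | .leaf => True
  | .node l v r => 0 < v ∧ l.PosLabels ∧ r.PosLabels

/-- No vertex has the same label as its left child. -/
def BTree.NoLeftEq : BTree → Prop
  | .leaf => True
  | .node l v r => l.root? ≠ some v ∧ l.NoLeftEq ∧ r.NoLeftEq

/-- No vertex has the same label as its right child. -/
def BTree.NoRightEq : BTree → Prop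
  | .leaf => True
  | .node l v r => r.root? ≠ some v ∧ l.NoRightEq ∧ r.NoRightEq

/-- `τ ∈ R`: a weakly decreasing binary plane tree (labeled by positive integers)
in which no vertex has the same label as its left child. -/
def BTree.InR (t : BTree) : Prop := t.WeaklyDecreasing ∧ t.PosLabels ∧ t.NoLeftEq

/-- `τ ∈ L`: a weakly decreasing binary plane tree (labeled by positive integers)
in which no vertex has the same label as its right child. -/
def BTree.InL (t : BTree) : Prop := t.WeaklyDecreasing ∧ t.PosLabels ∧ t.NoRightEq

lemma blocks_eq_singleton {n : ℕ} {w : List ℕ} (h : n ∉ w) : blocks n w = [w] := by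
  induction w with
  | nil => rfl
  | cons a l ih =>
    simp only [List.mem_cons, not_or] at h
    simp [blocks, Ne.symm h.1, ih h.2]

lemma blocks_append_cons (n : ℕ) (A B : List ℕ) :
    blocks n (A ++ n :: B) = blocks n A ++ blocks n B := by
  induction A with
  | nil => simp [blocks]
  | cons a l ih =>
    obtain ⟨x, t, hx⟩ := List.exists_cons_of_ne_nil (blocks_ne_nil n l)
    by_cases h : a = n <;> simp [blocks, h, ih, hx]

lemma foldr_max_eq_of_mem {n : ℕ} {w : List ℕ} (hn : n ∈ w) (hw : ∀ x ∈ w, x ≤ n) :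
    w.foldr max 0 = n := by
  refine le_antisymm (hw _ (foldr_max_mem (List.ne_nil_of_mem hn))) ?_
  clear hw
  induction w with
  | nil => simp at hn
  | cons a l ih =>
    rcases List.mem_cons.mp hn with rfl | h
    · exact le_max_left _ _
    · exact (ih h).trans (le_max_right _ _)

/-- The recursion defining `slow` holds for any upper bound `n` of the letters,
even if `n` does not occur. -/
lemma slow_eq_of_forall_le {n : ℕ} {w : List ℕ} (hw : ∀ x ∈ w, x ≤ n) :
    slow w = slow (blocks n w).headI ++
      ((blocks n w).tail.map fun A => slow A ++ [n]).flatten := by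
  by_cases hn : n ∈ w
  · rw [slow, dif_neg (List.ne_nil_of_mem hn)]
    simp only [foldr_max_eq_of_mem hn hw]
    rw [List.attach_map_val (f := fun A => slow A ++ [n]), foldr_max_eq_of_mem hn hw]
  · simp [blocks_eq_singleton hn]

lemma slow_append_cons {n : ℕ} {A B : List ℕ} (hA : ∀ x ∈ A, x ≤ n) (hB : ∀ x ∈ B, x < n) :
    slow (A ++ n :: B) = slow A ++ slow B ++ [n] := by
  have hAB : ∀ x ∈ A ++ n :: B, x ≤ n := by
    intro x hx
    rcases List.mem_append.mp hx with h | h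
    · exact hA x h
    · rcases List.mem_cons.mp h with rfl | h
      · exact le_rfl
      · exact (hB x h).le
  rw [slow_eq_of_forall_le hAB, slow_eq_of_forall_le hA, blocks_append_cons,
    blocks_eq_singleton fun h => lt_irrefl n (hB n h)]
  obtain ⟨x, t, hx⟩ := List.exists_cons_of_ne_nil (blocks_ne_nil n A)
  simp [hx]

lemma BTree.WeaklyDecreasing.lt_of_root?_ne {t : BTree} {v : ℕ} (ht : t.WeaklyDecreasing)
    (hle : ∀ x ∈ t.inOrder, x ≤ v) (hv : t.root? ≠ some v) : ∀ x ∈ t.inOrder, x < v := by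
  cases t with
  | leaf => simp [BTree.inOrder]
  | node l u r =>
    have huv : u < v := lt_of_le_of_ne (hle u (by simp [BTree.inOrder])) fun h =>
      hv (by simp [BTree.root?, h])
    intro x hx
    simp only [BTree.inOrder, List.mem_append, List.mem_cons] at hx
    rcases hx with h | rfl | h
    · exact (ht.1 x h).trans_lt huv
    · exact huv
    · exact (ht.2.1 x h).trans_lt huv

/-- For every tree `τ ∈ L` (a weakly decreasing binary plane tree in which no vertex
has the same label as its right child), applying `slow` to the in-order reading of `τ`
yields the postorder reading of `τ`. -/
theorem slow_inOrder_eq_postOrder (t : BTree) (ht : t.InL) :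
    slow t.inOrder = t.postOrder := by
  induction t with
  | leaf => simp [BTree.inOrder, BTree.postOrder, slow]
  | node l v r ihl ihr =>
    obtain ⟨⟨hl, hr, hwl, hwr⟩, ⟨_, hpl, hpr⟩, hne, hnl, hnr⟩ := ht
    rw [BTree.inOrder, slow_append_cons hl (hwr.lt_of_root?_ne hr hne),
      ihl ⟨hwl, hpl, hnl⟩, ihr ⟨hwr, hpr, hnr⟩, BTree.postOrder]
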